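/- If 0 < U₁ ≤ U₂, then τ₁ ≤ τ₂ and Δ₁(T) ≤ Δ₂(T) for all 0 ≤ T ≤ τ₂ (with Δ₁(T) = 0 for T ≥ τ₁ and Δ₂(T) = 0 for T ≥ τ₂). -/

import Mathlib

open Set MeasureTheory Filter Topology

noncomputable section

/-- The context of the BCS-Bogoliubov model: the cutoff `eps`, the Debye energy `om = ℏω_D`,
the potential `U` with bounds `U₁ ≤ U ≤ U₂`, the constant `a`, the temperatures
`tau₁, tau₂, T₀, Tc`, the solutions `Δ₁, Δ₂` of the constant-potential gap equations,
the constant `Mz = max_{z ≥ 0} z / cosh z` and the constant `MT = M_T`. -/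
structure BCSContext where
  eps : ℝ
  om : ℝ
  U : ℝ → ℝ → ℝ
  U₁ : ℝ
  U₂ : ℝ
  Umax : ℝ
  Umin : ℝ
  a : ℝ
  tau₁ : ℝ
  tau₂ : ℝ
  Δ₁ : ℝ → ℝ
  Δ₂ : ℝ → ℝ
  Tc : ℝ
  T₀ : ℝ
  Mz : ℝ
  MT : ℝ
  heps : 0 < eps
  hepsom : eps < om
  hU₁pos : 0 < U₁
  hU₁₂ : U₁ ≤ U₂
  hUsmooth : ContDiffOn ℝ 2 (fun p : ℝ × ℝ => U p.1 p.2) (Icc eps om ×ˢ Icc eps om)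
  hUlb : ∀ x ∈ Icc eps om, ∀ ξ ∈ Icc eps om, U₁ ≤ U x ξ
  hUub : ∀ x ∈ Icc eps om, ∀ ξ ∈ Icc eps om, U x ξ ≤ U₂
  hUmax : IsGreatest (Set.image2 U (Icc eps om) (Icc eps om)) Umax
  hUmin : IsLeast (Set.image2 U (Icc eps om) (Icc eps om)) Umin
  ha : a = (Umax / Umin) ^ 2
  htau₁pos : 0 < tau₁
  htau₂pos : 0 < tau₂
  htau₁ : 1 = U₁ * (∫ ξ in eps..om, Real.tanh (ξ / (2 * tau₁)) / ξ)
  htau₂ : 1 = U₂ * (∫ ξ in eps..om, Real.tanh (ξ / (2 * tau₂)) / ξ)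
  hΔ₁nonneg : ∀ T, 0 ≤ Δ₁ T
  hΔ₂nonneg : ∀ T, 0 ≤ Δ₂ T
  hΔ₁cont : Continuous Δ₁
  hΔ₂cont : Continuous Δ₂
  hΔ₁anti : StrictAntiOn Δ₁ (Icc 0 tau₁)
  hΔ₂anti : StrictAntiOn Δ₂ (Icc 0 tau₂)
  hΔ₁eq : ∀ T ∈ Ioc 0 tau₁, U₁ * (∫ ξ in eps..om,
      Real.tanh (Real.sqrt (ξ ^ 2 + Δ₁ T ^ 2) / (2 * T)) / Real.sqrt (ξ ^ 2 + Δ₁ T ^ 2)) = 1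
  hΔ₂eq : ∀ T ∈ Ioc 0 tau₂, U₂ * (∫ ξ in eps..om,
      Real.tanh (Real.sqrt (ξ ^ 2 + Δ₂ T ^ 2) / (2 * T)) / Real.sqrt (ξ ^ 2 + Δ₂ T ^ 2)) = 1
  hΔ₁zero : ∀ T, tau₁ ≤ T → Δ₁ T = 0
  hΔ₂zero : ∀ T, tau₂ ≤ T → Δ₂ T = 0
  hTc₁ : tau₁ ≤ Tc
  hTc₂ : Tc ≤ tau₂
  hT₀₁ : tau₁ < T₀
  hT₀₂ : T₀ < Tc
  hMz : IsGreatest ((fun z => z / Real.cosh z) '' Set.Ici (0 : ℝ)) Mz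
  hMT : MT = 4 * a * U₂ * Mz ^ 2 /
      (eps * U₁ *
        (Real.tanh (eps / (2 * Tc)) - (eps / (2 * Tc)) / Real.cosh (eps / (2 * Tc)) ^ 2) *
        (∫ ξ in eps..om, (ξ ^ 2 + Δ₂ 0 ^ 2) ^ (-(3 : ℝ) / 2)))

namespace BCSContext

/-- The energy interval `I = [ε, ℏω_D]`. -/
def Iset (C : BCSContext) : Set ℝ := Icc C.eps C.om

/-- The rectangle `D = [T₀, T_c] × I`. -/
def Dset (C : BCSContext) : Set (ℝ × ℝ) := Icc C.T₀ C.Tc ×ˢ Icc C.eps C.om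

end BCSContext

/-- The operator `A` of the squared BCS-Bogoliubov gap equation. -/
def opA (C : BCSContext) (f : ℝ → ℝ → ℝ) (T x : ℝ) : ℝ :=
  (∫ ξ in C.eps..C.om, C.U x ξ * Real.sqrt (f T ξ / (ξ ^ 2 + f T ξ)) *
      Real.tanh (Real.sqrt (ξ ^ 2 + f T ξ) / (2 * T))) ^ 2

/-- Partial derivative with respect to the temperature `T` (within `[T₀, T_c]`). -/
def pderivT (C : BCSContext) (g : ℝ → ℝ → ℝ) (T x : ℝ) : ℝ :=
  derivWithin (fun s => g s x) (Icc C.T₀ C.Tc) T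

/-- Partial derivative with respect to the energy `x` (within `I = [ε, ℏω_D]`). -/
def pderivX (C : BCSContext) (g : ℝ → ℝ → ℝ) (T x : ℝ) : ℝ :=
  derivWithin (fun y => g T y) (Icc C.eps C.om) x

/-- Membership in the set `W`. -/
def memW (C : BCSContext) (f : ℝ → ℝ → ℝ) : Prop :=
  ContDiffOn ℝ 2 (fun p : ℝ × ℝ => f p.1 p.2) C.Dset ∧
  (∀ T ∈ Icc C.T₀ C.Tc, ∀ x ∈ C.Iset, C.Δ₁ T ^ 2 ≤ f T x ∧ f T x ≤ C.Δ₂ T ^ 2) ∧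
  (∀ x ∈ C.Iset, f C.Tc x = 0) ∧
  (∀ T ∈ Ico C.T₀ C.Tc, ∀ x ∈ C.Iset, ∀ x₁ ∈ C.Iset, f T x ≤ C.a * f T x₁) ∧
  (∀ x ∈ C.Iset, ∀ x₁ ∈ C.Iset,
      -(pderivT C f C.Tc x) ≤ C.a * -(pderivT C f C.Tc x₁)) ∧
  (∀ T ∈ Icc C.T₀ C.Tc, ∀ x ∈ C.Iset, pderivT C f T x < 0) ∧
  (∀ T ∈ Icc C.T₀ C.Tc, ∀ x ∈ C.Iset, -(pderivT C f T x) ≤ C.MT)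

/-- The condition `a^{1/4} · max_{(T,x) ∈ D} ∫_I (U(x,ξ)/ξ) tanh(ξ/(2T)) dξ ≤ 1`. -/
def gapCondition (C : BCSContext) : Prop :=
  ∀ T ∈ Icc C.T₀ C.Tc, ∀ x ∈ C.Iset,
    C.a ^ ((1 : ℝ) / 4) * (∫ ξ in C.eps..C.om, C.U x ξ / ξ * Real.tanh (ξ / (2 * T))) ≤ 1

instance (C : BCSContext) : CompactSpace ↥C.Dset :=
  isCompact_iff_compactSpace.mp (isCompact_Icc.prod isCompact_Icc)

-- Extension of a continuous function on `D` to a function on `ℝ × ℝ` (by `0` outside `D`).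
open Classical in
def extFun (C : BCSContext) (F : C(↥C.Dset, ℝ)) : ℝ → ℝ → ℝ :=
  fun T x => if h : (T, x) ∈ C.Dset then F ⟨(T, x), h⟩ else 0

/-- The set `W` regarded as a subset of the Banach space `C(D)`. -/
def WSet (C : BCSContext) : Set C(↥C.Dset, ℝ) :=
  {F | ∃ f : ℝ → ℝ → ℝ, memW C f ∧ ∀ p : ↥C.Dset, F p = f (p : ℝ × ℝ).1 (p : ℝ × ℝ).2}

theorem continuous_real_tanh : Continuous Real.tanh := by
  have h : Real.tanh = fun x => Real.sinh x / Real.cosh x :=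
    funext Real.tanh_eq_sinh_div_cosh
  rw [h]
  exact Real.continuous_sinh.div Real.continuous_cosh fun x => (Real.cosh_pos x).ne'

theorem strictMono_real_tanh : StrictMono Real.tanh := by
  intro x y hxy
  have h : 0 < Real.sinh (y - x) := Real.sinh_pos_iff.2 (sub_pos.2 hxy)
  rw [Real.sinh_sub] at h
  rw [Real.tanh_eq_sinh_div_cosh, Real.tanh_eq_sinh_div_cosh,
    div_lt_div_iff₀ (Real.cosh_pos x) (Real.cosh_pos y)]
  linarith

theorem strictAntiOn_tanh_div_self : StrictAntiOn (fun x => Real.tanh x / x) (Ioi 0) := by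
  apply strictAntiOn_of_deriv_neg (convex_Ioi 0)
  · exact continuous_real_tanh.continuousOn.div continuousOn_id fun x hx => ne_of_gt hx
  · intro x hx
    rw [interior_Ioi] at hx
    have hx0 : 0 < x := hx
    have hc := Real.cosh_pos x
    have hd : HasDerivAt (fun y => Real.sinh y / Real.cosh y / y)
        (((Real.cosh x * Real.cosh x - Real.sinh x * Real.sinh x) / Real.cosh x ^ 2 * x
          - Real.sinh x / Real.cosh x * 1) / x ^ 2) x :=
      ((Real.hasDerivAt_sinh x).div (Real.hasDerivAt_cosh x) hc.ne').div
        (hasDerivAt_id x) hx0.ne'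
    simp only [Real.tanh_eq_sinh_div_cosh]
    rw [hd.deriv]
    apply div_neg_of_neg_of_pos _ (by positivity)
    have hs : x < Real.sinh x := Real.self_lt_sinh_iff.2 hx0
    have hsc : Real.sinh x ≤ Real.sinh x * Real.cosh x :=
      le_mul_of_one_le_right (hx0.trans hs).le (Real.one_le_cosh x)
    have h1 : Real.cosh x * Real.cosh x - Real.sinh x * Real.sinh x = 1 := by
      nlinarith [Real.cosh_sq x]
    have h2 : 1 / Real.cosh x ^ 2 * x - Real.sinh x / Real.cosh x * 1
        = (x - Real.sinh x * Real.cosh x) / Real.cosh x ^ 2 := by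
      field_simp
    rw [h1, h2]
    exact div_neg_of_neg_of_pos (by linarith) (by positivity)

theorem tanh_div_lt_tanh_div {c x y : ℝ} (hc : 0 < c) (hx : 0 < x) (hxy : x < y) :
    Real.tanh (y / c) / y < Real.tanh (x / c) / x := by
  have h := strictAntiOn_tanh_div_self (mem_Ioi.2 (div_pos hx hc))
    (mem_Ioi.2 (div_pos (hx.trans hxy) hc)) (div_lt_div_of_pos_right hxy hc)
  simp only [div_div_eq_mul_div] at h
  rw [mul_div_right_comm, mul_div_right_comm] at h
  exact lt_of_mul_lt_mul_right h hc.le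

theorem integral_tanh_div_lt_of_lt {a b s t : ℝ} (ha : 0 < a) (hab : a < b)
    (hs : 0 < s) (hst : s < t) :
    ∫ ξ in a..b, Real.tanh (ξ / (2 * t)) / ξ < ∫ ξ in a..b, Real.tanh (ξ / (2 * s)) / ξ := by
  have hcont : ∀ r : ℝ, ContinuousOn (fun ξ => Real.tanh (ξ / (2 * r)) / ξ) (Icc a b) :=
    fun r => (continuous_real_tanh.comp (continuous_id.div_const _)).continuousOn.div
      continuousOn_id fun ξ hξ => (ha.trans_le hξ.1).ne'
  have hlt : ∀ ξ, 0 < ξ → Real.tanh (ξ / (2 * t)) / ξ < Real.tanh (ξ / (2 * s)) / ξ := by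
    intro ξ hξ
    exact div_lt_div_of_pos_right
      (strictMono_real_tanh (div_lt_div_of_pos_left hξ (by linarith) (by linarith))) hξ
  exact intervalIntegral.integral_lt_integral_of_continuousOn_of_le_of_exists_lt hab
    (hcont t) (hcont s) (fun ξ hξ => (hlt ξ (ha.trans hξ.1)).le)
    ⟨a, left_mem_Icc.2 hab.le, hlt a ha⟩

theorem integral_gap_lt_of_lt {a b T d e : ℝ} (ha : 0 < a) (hab : a < b)
    (hT : 0 < T) (hd : 0 ≤ d) (hde : d < e) :
    ∫ ξ in a..b, Real.tanh (Real.sqrt (ξ ^ 2 + e ^ 2) / (2 * T)) / Real.sqrt (ξ ^ 2 + e ^ 2)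
      < ∫ ξ in a..b,
        Real.tanh (Real.sqrt (ξ ^ 2 + d ^ 2) / (2 * T)) / Real.sqrt (ξ ^ 2 + d ^ 2) := by
  have hpos : ∀ r ξ : ℝ, 0 < ξ → 0 < Real.sqrt (ξ ^ 2 + r ^ 2) :=
    fun r ξ hξ => Real.sqrt_pos.2 (by positivity)
  have hcont : ∀ r : ℝ, ContinuousOn (fun ξ =>
      Real.tanh (Real.sqrt (ξ ^ 2 + r ^ 2) / (2 * T)) / Real.sqrt (ξ ^ 2 + r ^ 2))
      (Icc a b) := by
    intro r
    have hsqrt : Continuous fun ξ : ℝ => Real.sqrt (ξ ^ 2 + r ^ 2) := by fun_prop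
    exact (continuous_real_tanh.comp (hsqrt.div_const _)).continuousOn.div
      hsqrt.continuousOn fun ξ hξ => (hpos r ξ (ha.trans_le hξ.1)).ne'
  have hlt : ∀ ξ, 0 < ξ →
      Real.tanh (Real.sqrt (ξ ^ 2 + e ^ 2) / (2 * T)) / Real.sqrt (ξ ^ 2 + e ^ 2)
        < Real.tanh (Real.sqrt (ξ ^ 2 + d ^ 2) / (2 * T)) / Real.sqrt (ξ ^ 2 + d ^ 2) := by
    intro ξ hξ
    exact tanh_div_lt_tanh_div (by linarith) (hpos d ξ hξ)
      (Real.sqrt_lt_sqrt (by positivity) (by nlinarith))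
  exact intervalIntegral.integral_lt_integral_of_continuousOn_of_le_of_exists_lt hab
    (hcont e) (hcont d) (fun ξ hξ => (hlt ξ (ha.trans hξ.1)).le)
    ⟨a, left_mem_Icc.2 hab.le, hlt a ha⟩

theorem stmt_18 (eps om U₁ U₂ tau₁ tau₂ : ℝ) (Δ₁ Δ₂ : ℝ → ℝ)
    (heps : 0 < eps) (hepsom : eps < om)
    (hU₁ : 0 < U₁) (hU₁₂ : U₁ ≤ U₂)
    (htau₁pos : 0 < tau₁) (htau₂pos : 0 < tau₂)
    (htau₁ : 1 = U₁ * (∫ ξ in eps..om, Real.tanh (ξ / (2 * tau₁)) / ξ))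
    (htau₂ : 1 = U₂ * (∫ ξ in eps..om, Real.tanh (ξ / (2 * tau₂)) / ξ))
    (hΔ₁nonneg : ∀ T, 0 ≤ Δ₁ T) (hΔ₂nonneg : ∀ T, 0 ≤ Δ₂ T)
    (hΔ₁cont : Continuous Δ₁) (hΔ₂cont : Continuous Δ₂)
    (hΔ₁anti : StrictAntiOn Δ₁ (Icc 0 tau₁)) (hΔ₂anti : StrictAntiOn Δ₂ (Icc 0 tau₂))
    (hΔ₁eq : ∀ T ∈ Ioc 0 tau₁, U₁ * (∫ ξ in eps..om,
        Real.tanh (Real.sqrt (ξ ^ 2 + Δ₁ T ^ 2) / (2 * T)) /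
          Real.sqrt (ξ ^ 2 + Δ₁ T ^ 2)) = 1)
    (hΔ₂eq : ∀ T ∈ Ioc 0 tau₂, U₂ * (∫ ξ in eps..om,
        Real.tanh (Real.sqrt (ξ ^ 2 + Δ₂ T ^ 2) / (2 * T)) /
          Real.sqrt (ξ ^ 2 + Δ₂ T ^ 2)) = 1)
    (hΔ₁zero : ∀ T, tau₁ ≤ T → Δ₁ T = 0) (hΔ₂zero : ∀ T, tau₂ ≤ T → Δ₂ T = 0) :
    tau₁ ≤ tau₂ ∧ ∀ T ∈ Icc (0 : ℝ) tau₂, Δ₁ T ≤ Δ₂ T := by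
  have not_lt_of_gap : ∀ I J : ℝ, U₁ * I = 1 → U₂ * J = 1 → ¬ I < J := by
    intro I J hI hJ hIJ
    have hI0 : 0 < I := pos_of_mul_pos_right (hI ▸ one_pos) hU₁.le
    have h₁ : U₁ * I ≤ U₂ * I := mul_le_mul_of_nonneg_right hU₁₂ hI0.le
    have h₂ : U₂ * I < U₂ * J := mul_lt_mul_of_pos_left hIJ (hU₁.trans_le hU₁₂)
    linarith
  have htau : tau₁ ≤ tau₂ := by
    by_contra! h
    exact not_lt_of_gap _ _ htau₁.symm htau₂.symm
      (integral_tanh_div_lt_of_lt heps hepsom htau₂pos h)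
  have hpos : ∀ T ∈ Ioi (0 : ℝ), Δ₁ T ≤ Δ₂ T := by
    intro T hT
    rcases le_total tau₁ T with h | h
    · rw [hΔ₁zero T h]
      exact hΔ₂nonneg T
    · by_contra! hlt
      exact not_lt_of_gap _ _ (hΔ₁eq T ⟨hT, h⟩) (hΔ₂eq T ⟨hT, h.trans htau⟩)
        (integral_gap_lt_of_lt heps hepsom hT (hΔ₂nonneg T) hlt)
  refine ⟨htau, fun T hT => ?_⟩
  have hsub : closure (Ioi (0 : ℝ)) ⊆ {T | Δ₁ T ≤ Δ₂ T} :=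
    closure_minimal hpos (isClosed_le hΔ₁cont hΔ₂cont)
  rw [closure_Ioi] at hsub
  exact hsub hT.1

end
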